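/- Let Γ be a simple graph on a nonempty finite vertex type V, let H = SEP(Γ) ≤ Equiv.Perm V be its SEP group, and let Γ̃ be the prime graph of H: the simple graph on the subtype P = {p : ℕ // p.Prime ∧ p ∣ Nat.card H} whose adjacency relation is p ≠ q ∧ ∃ g ∈ H, orderOf (g : Equiv.Perm V) = p.1 * q.1. Then Γ is not isomorphic to Γ̃, i.e., the type of graph isomorphisms Γ ≃g Γ̃ is empty. -/

import Mathlib

/-- The SEP group of a graph: the subgroup of `Equiv.Perm V` generated by the
transpositions that are automorphisms of `Γ`. -/
def SEP {V : Type*} [Fintype V] [DecidableEq V] (Γ : SimpleGraph V) : Subgroup (Equiv.Perm V) :=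
  Subgroup.closure {σ : Equiv.Perm V | ∃ u v : V, u ≠ v ∧ σ = Equiv.swap u v ∧
    ∀ x y : V, Γ.Adj (σ x) (σ y) ↔ Γ.Adj x y}

/-- The prime graph of the SEP group of `Γ`: vertices are the primes dividing
`|SEP(Γ)|`, with an edge between distinct primes `p`, `q` iff `SEP(Γ)` contains an
element of order `p * q`. -/
def primeGraphSEP {V : Type*} [Fintype V] [DecidableEq V] (Γ : SimpleGraph V) :
    SimpleGraph {p : ℕ // p.Prime ∧ p ∣ Nat.card (SEP Γ)} where
  Adj p q := p ≠ q ∧ ∃ g : Equiv.Perm V, g ∈ SEP Γ ∧ orderOf g = p.1 * q.1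
  symm := by
    constructor
    rintro p q ⟨hne, g, hg, hord⟩
    exact ⟨hne.symm, g, hg, by rw [hord, mul_comm]⟩
  loopless := by constructor; rintro p ⟨hne, -⟩; exact hne rfl

/-- A prime dividing the order of a permutation group on `V` is at most `|V|`. -/
theorem Nat.Prime.le_card_of_dvd_card_subgroup_perm {V : Type*} [Fintype V] [DecidableEq V]
    {H : Subgroup (Equiv.Perm V)} {p : ℕ} (hp : p.Prime) (hdvd : p ∣ Nat.card H) :
    p ≤ Fintype.card V := by
  have h : p ∣ (Fintype.card V).factorial := by
    rw [← Fintype.card_perm, ← Nat.card_eq_fintype_card]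
    exact hdvd.trans H.card_subgroup_dvd_card
  exact hp.dvd_factorial.mp h

/-- no graph is isomorphic to the prime graph of its SEP group. -/
theorem not_isomorphic_primeGraphSEP {V : Type*} [Fintype V] [DecidableEq V] [Nonempty V]
    (Γ : SimpleGraph V) :
    IsEmpty (Γ ≃g primeGraphSEP Γ) := by
  refine ⟨fun e => ?_⟩
  have hmaps : ∀ v ∈ (Finset.univ : Finset V),
      (e v : ℕ) ∈ Finset.Icc 2 (Fintype.card V) := fun v _ =>
    Finset.mem_Icc.mpr ⟨(e v).2.1.two_le,
      (e v).2.1.le_card_of_dvd_card_subgroup_perm (e v).2.2⟩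
  have hle := Finset.card_le_card_of_injOn (fun v => (e v : ℕ)) hmaps
    (Subtype.val_injective.comp e.injective).injOn
  have hpos : 0 < Fintype.card V := Fintype.card_pos
  rw [Finset.card_univ, Nat.card_Icc] at hle
  omega
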